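/- Let A₁ and A₂ be two finite sets of atoms with A₁ ⊆ A₂, and let ⟨∇,t⟩ and ⟨∇,s⟩ be A₁-based terms-in-context having an A₁-based least general generalization ⟨Γ₁,r₁⟩ and an A₂-based least general generalization ⟨Γ₂,r₂⟩. Then Γ₂ ⊢ r₁ ⪯ r₂, i.e., there exists a substitution φ such that Γ₂ ⊢ r₁φ ≈ r₂. -/

import Mathlib

set_option maxHeartbeats 1000000
abbrev Atom := ℕ
abbrev Var := ℕ
abbrev Fn := ℕ
abbrev NPerm := List (Atom × Atom)
def swapAtom (a b c : Atom) : Atom := if c = a then b else if c = b then a else c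
def permAtom : NPerm → Atom → Atom
  | [], c => c
  | (a, b) :: π, c => swapAtom a b (permAtom π c)
def permInv (π : NPerm) : NPerm := π.reverse
inductive NTerm where
  | app : Fn → List NTerm → NTerm
  | atom : Atom → NTerm
  | abs : Atom → NTerm → NTerm
  | susp : NPerm → Var → NTerm

def permTerm (π : NPerm) : NTerm → NTerm
  | .app f ts => .app f (ts.attach.map (fun x => permTerm π x.1))
  | .atom a => .atom (permAtom π a)
  | .abs a t => .abs (permAtom π a) (permTerm π t)
  | .susp ρ X => .susp (π ++ ρ) X
decreasing_by
  all_goals (simp_wf; try omega)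
  all_goals (have := List.sizeOf_lt_of_mem x.2; omega)

/-- Substitutions (total maps from variables to terms; identity almost everywhere
is not required for the statements). -/
abbrev NSubst := Var → NTerm

def idSubst : NSubst := fun X => .susp [] X

/-- Application of a substitution to a term (allowing atom capture and forcing
suspended permutations). -/
def substTerm (σ : NSubst) : NTerm → NTerm
  | .app f ts => .app f (ts.attach.map (fun x => substTerm σ x.1))
  | .atom a => .atom a
  | .abs a t => .abs a (substTerm σ t)
  | .susp π X => permTerm π (σ X)
decreasing_by
  all_goals (simp_wf; try omega)
  all_goals (have := List.sizeOf_lt_of_mem x.2; omega)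

/-- Composition of substitutions: `t (σθ) = (tσ)θ`. -/
def substComp (σ θ : NSubst) : NSubst := fun X => substTerm θ (σ X)

/-- Freshness contexts: finite sets of constraints `a # X`. -/
abbrev FCtx := Finset (Atom × Var)

/-- The freshness relation `Δ ⊢ a # t` (Urban–Pitts–Gabbay rules), stated for an
arbitrary set of freshness constraints. -/
inductive NFresh (Δ : Set (Atom × Var)) : Atom → NTerm → Prop
  | atom {a b : Atom} : a ≠ b → NFresh Δ a (.atom b)
  | susp {a : Atom} {π : NPerm} {X : Var} :
      (permAtom (permInv π) a, X) ∈ Δ → NFresh Δ a (.susp π X)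
  | app {a : Atom} {f : Fn} {ts : List NTerm} :
      (∀ t ∈ ts, NFresh Δ a t) → NFresh Δ a (.app f ts)
  | abs1 {a : Atom} {t : NTerm} : NFresh Δ a (.abs a t)
  | abs2 {a b : Atom} {t : NTerm} : a ≠ b → NFresh Δ a t → NFresh Δ a (.abs b t)

/-- The α-equivalence relation `Δ ⊢ t ≈ s` (Urban–Pitts–Gabbay rules). -/
inductive NAlpha (Δ : Set (Atom × Var)) : NTerm → NTerm → Prop
  | atom (a : Atom) : NAlpha Δ (.atom a) (.atom a)
  | abs1 {a : Atom} {t t' : NTerm} : NAlpha Δ t t' → NAlpha Δ (.abs a t) (.abs a t')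
  | abs2 {a b : Atom} {t t' : NTerm} : a ≠ b → NAlpha Δ t (permTerm [(a, b)] t') →
      NFresh Δ a t' → NAlpha Δ (.abs a t) (.abs b t')
  | susp {π π' : NPerm} {X : Var} :
      (∀ a : Atom, permAtom π a ≠ permAtom π' a → (a, X) ∈ Δ) →
      NAlpha Δ (.susp π X) (.susp π' X)
  | app {f : Fn} {ts ss : List NTerm} : ts.length = ss.length →
      (∀ p ∈ List.zip ts ss, NAlpha Δ p.1 p.2) →
      NAlpha Δ (.app f ts) (.app f ss)

/-- `FA⁻ˢ(t)`: atoms occurring freely in `t`, ignoring suspensions. -/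
def FAnoSusp : NTerm → Finset Atom
  | .app _ ts => (ts.attach.map (fun x => FAnoSusp x.1)).foldr (· ∪ ·) ∅
  | .atom a => {a}
  | .abs a t => FAnoSusp t \ {a}
  | .susp _ _ => ∅
decreasing_by
  all_goals (simp_wf; try omega)
  all_goals (have := List.sizeOf_lt_of_mem x.2; omega)

/-- A substitution respects a freshness context. -/
def Respects (σ : NSubst) (Δ : FCtx) : Prop :=
  ∀ a X, (a, X) ∈ Δ → a ∉ FAnoSusp (σ X)

/-! ### The algorithm FC -/

/-- A finite set of atomic freshness formulas `a # t`. -/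
abbrev FProb := Multiset (Atom × NTerm)

/-- One step of the algorithm FC, transforming pairs `(F; Δ)`. -/
inductive FCStep : FProb × FCtx → FProb × FCtx → Prop
  | del {a b : Atom} {F : FProb} {Δ : FCtx} : a ≠ b →
      FCStep ((a, .atom b) ::ₘ F, Δ) (F, Δ)
  | abs1 {a : Atom} {t : NTerm} {F : FProb} {Δ : FCtx} :
      FCStep ((a, .abs a t) ::ₘ F, Δ) (F, Δ)
  | abs2 {a b : Atom} {t : NTerm} {F : FProb} {Δ : FCtx} : a ≠ b →
      FCStep ((a, .abs b t) ::ₘ F, Δ) ((a, t) ::ₘ F, Δ)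
  | dec {a : Atom} {f : Fn} {ts : List NTerm} {F : FProb} {Δ : FCtx} :
      FCStep ((a, .app f ts) ::ₘ F, Δ) (↑(ts.map (fun t => (a, t))) + F, Δ)
  | sus {a : Atom} {π : NPerm} {X : Var} {F : FProb} {Δ : FCtx} :
      FCStep ((a, .susp π X) ::ₘ F, Δ) (F, insert (permAtom (permInv π) a, X) Δ)

/-- The algorithm FC succeeds on `F` with result `Γ`. -/
def FCReaches (F : FProb) (Γ : FCtx) : Prop :=
  Relation.ReflTransGen FCStep (F, ∅) (0, Γ)

/-- The algorithm FC fails on `F` (reaches a stuck state with remaining formulas). -/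
def FCFails (F : FProb) : Prop :=
  ∃ st : FProb × FCtx, Relation.ReflTransGen FCStep (F, ∅) st ∧ st.1 ≠ 0 ∧
    ∀ st', ¬ FCStep st st'

/-- The freshness problem `{a # Xσ | a#X ∈ Δ}` defining the instance `Δσ`. -/
def ctxSubstProb (Δ : FCtx) (σ : NSubst) : FProb :=
  Δ.val.map (fun c => (c.1, σ c.2))

/-! ### Terms-in-context and the subsumption order -/

/-- A term-in-context. -/
abbrev TIC := FCtx × NTerm

/-- `p ⪯ q`: the term-in-context `p` is more general than `q`.  (The condition
`p.1 σ ⊆ q.1` is expressed, equivalently by the properties of FC, as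
`q.1 ⊢ a # Xσ` for all `a # X ∈ p.1`.) -/
def TIC.Le (p q : TIC) : Prop :=
  ∃ σ : NSubst, Respects σ p.1 ∧
    (∀ c ∈ p.1, NFresh (↑q.1 : Set (Atom × Var)) c.1 (σ c.2)) ∧
    NAlpha (↑q.1 : Set (Atom × Var)) (substTerm σ p.2) q.2

/-- The strict part of `⪯`. -/
def TIC.Lt (p q : TIC) : Prop := TIC.Le p q ∧ ¬ TIC.Le q p

/-- Equi-generality `≃`. -/
def TIC.Equiv (p q : TIC) : Prop := TIC.Le p q ∧ TIC.Le q p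

/-- `r` is a generalization of `p₁` and `p₂`. -/
def IsGen (r p₁ p₂ : TIC) : Prop := TIC.Le r p₁ ∧ TIC.Le r p₂

/-! ### Atoms, variables, basedness -/

def permAtoms : NPerm → Finset Atom
  | [] => ∅
  | (a, b) :: π => insert a (insert b (permAtoms π))

def termAtoms : NTerm → Finset Atom
  | .app _ ts => (ts.attach.map (fun x => termAtoms x.1)).foldr (· ∪ ·) ∅
  | .atom a => {a}
  | .abs a t => insert a (termAtoms t)
  | .susp π _ => permAtoms π
decreasing_by
  all_goals (simp_wf; try omega)
  all_goals (have := List.sizeOf_lt_of_mem x.2; omega)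

def termVars : NTerm → Finset Var
  | .app _ ts => (ts.attach.map (fun x => termVars x.1)).foldr (· ∪ ·) ∅
  | .atom _ => ∅
  | .abs _ t => termVars t
  | .susp _ X => {X}
decreasing_by
  all_goals (simp_wf; try omega)
  all_goals (have := List.sizeOf_lt_of_mem x.2; omega)

/-- `FA(t)`: the atoms occurring freely in `t` (with `FA(π·X) = Atoms(π)`). -/
def termFA : NTerm → Finset Atom
  | .app _ ts => (ts.attach.map (fun x => termFA x.1)).foldr (· ∪ ·) ∅
  | .atom a => {a}
  | .abs a t => termFA t \ {a}
  | .susp π _ => permAtoms π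
decreasing_by
  all_goals (simp_wf; try omega)
  all_goals (have := List.sizeOf_lt_of_mem x.2; omega)

def ctxAtoms (Δ : FCtx) : Finset Atom := Δ.image Prod.fst
def ctxVars (Δ : FCtx) : Finset Var := Δ.image Prod.snd

def permBased (π : NPerm) (A : Finset Atom) : Prop := permAtoms π ⊆ A
def termBased (t : NTerm) (A : Finset Atom) : Prop := termAtoms t ⊆ A
def ctxBased (Δ : FCtx) (A : Finset Atom) : Prop := ctxAtoms Δ ⊆ A
def ticBased (p : TIC) (A : Finset Atom) : Prop := ctxBased p.1 A ∧ termBased p.2 A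

/-- The number of abstraction occurrences in a term. -/
def absCount : NTerm → ℕ
  | .app _ ts => (ts.attach.map (fun x => absCount x.1)).sum
  | .atom _ => 0
  | .abs _ t => absCount t + 1
  | .susp _ _ => 0
decreasing_by
  all_goals (simp_wf; try omega)
  all_goals (have := List.sizeOf_lt_of_mem x.2; omega)

/-! ### The nominal anti-unification algorithm 𝔑 -/

/-- Anti-unification triple `X : t ≜ s`. -/
abbrev AUT := Var × NTerm × NTerm

/-- A state of the algorithm 𝔑: the unsolved triples `P`, the store `S`, the
freshness context `Γ`, the substitution `σ`, and the set `V` of variables used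
so far (needed to express freshness of the generated variables). -/
structure NState where
  P : Multiset AUT
  S : Multiset AUT
  Γ : FCtx
  σ : NSubst
  V : Finset Var

/-- `σ{X ↦ u}`. -/
def updSubst (σ : NSubst) (X : Var) (u : NTerm) : NSubst :=
  substComp σ (fun Z => if Z = X then u else .susp [] Z)

/-- The head of a term (a function symbol together with its arity, an atom, the
abstraction operator, or a variable). -/
inductive NHead where
  | fn : Fn → ℕ → NHead
  | atom : Atom → NHead
  | abs : NHead
  | var : Var → NHead
deriving DecidableEq

def headOf : NTerm → NHead
  | .app f ts => .fn f ts.length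
  | .atom a => .atom a
  | .abs _ _ => .abs
  | .susp _ X => .var X

def IsSusp : NTerm → Prop
  | .susp _ _ => True
  | _ => False

def IsAbs : NTerm → Prop
  | .abs _ _ => True
  | _ => False

/-- The applicability condition of the rule Sol. -/
def SolCond (A : Finset Atom) (Δ : FCtx) (t s : NTerm) : Prop :=
  headOf t ≠ headOf s ∨ (IsSusp t ∧ IsSusp s) ∨
    (IsAbs t ∧ IsAbs s ∧
      ¬ ∃ c ∈ A, NFresh (↑Δ : Set (Atom × Var)) c t ∧ NFresh (↑Δ : Set (Atom × Var)) c s)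

open Classical in
/-- `{a # X | a ∈ A, Δ ⊢ a # t, Δ ⊢ a # s}`. -/
noncomputable def solSet (A : Finset Atom) (Δ : FCtx) (t s : NTerm) (X : Var) : FCtx :=
  (A.filter (fun a =>
    NFresh (↑Δ : Set (Atom × Var)) a t ∧ NFresh (↑Δ : Set (Atom × Var)) a s)).image
    (fun a => (a, X))

/-- `Γ{Y ↦ π·X}` on a freshness context. -/
def ctxRename (Γ : FCtx) (Y : Var) (π : NPerm) (X : Var) : FCtx :=
  Γ.image (fun c => if c.2 = Y then (permAtom (permInv π) c.1, X) else c)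

/-- One step of the algorithm 𝔑, with global parameters `A` and `Δ`. -/
inductive NStep (A : Finset Atom) (Δ : FCtx) : NState → NState → Prop
  | decApp {X : Var} {f : Fn} {ts ss : List NTerm} {P S : Multiset AUT} {Γ : FCtx}
      {σ : NSubst} {V : Finset Var} (Ys : List Var) :
      ts.length = ss.length → Ys.length = ts.length → Ys.Nodup →
      (∀ Y ∈ Ys, Y ∉ V) →
      NStep A Δ ⟨(X, .app f ts, .app f ss) ::ₘ P, S, Γ, σ, V⟩
        ⟨↑(List.zipWith (fun Y p => (Y, p)) Ys (List.zip ts ss)) + P, S, Γ,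
         updSubst σ X (.app f (Ys.map (fun Y => .susp [] Y))), V ∪ Ys.toFinset⟩
  | decAtom {X : Var} {a : Atom} {P S : Multiset AUT} {Γ : FCtx} {σ : NSubst}
      {V : Finset Var} :
      NStep A Δ ⟨(X, .atom a, .atom a) ::ₘ P, S, Γ, σ, V⟩
        ⟨P, S, Γ, updSubst σ X (.atom a), V⟩
  | abs {X : Var} {a b : Atom} {t s : NTerm} {P S : Multiset AUT} {Γ : FCtx}
      {σ : NSubst} {V : Finset Var} (Y : Var) (c : Atom) :
      Y ∉ V → c ∈ A →
      NFresh (↑Δ : Set (Atom × Var)) c (.abs a t) →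
      NFresh (↑Δ : Set (Atom × Var)) c (.abs b s) →
      NStep A Δ ⟨(X, .abs a t, .abs b s) ::ₘ P, S, Γ, σ, V⟩
        ⟨(Y, permTerm [(c, a)] t, permTerm [(c, b)] s) ::ₘ P, S, Γ,
         updSubst σ X (.abs c (.susp [] Y)), insert Y V⟩
  | sol {X : Var} {t s : NTerm} {P S : Multiset AUT} {Γ : FCtx} {σ : NSubst}
      {V : Finset Var} :
      SolCond A Δ t s →
      NStep A Δ ⟨(X, t, s) ::ₘ P, S, Γ, σ, V⟩
        ⟨P, (X, t, s) ::ₘ S, Γ ∪ solSet A Δ t s X, σ, V⟩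
  | mer {X Y : Var} {t₁ s₁ t₂ s₂ : NTerm} {P S : Multiset AUT} {Γ : FCtx}
      {σ : NSubst} {V : Finset Var} (π : NPerm) :
      X ≠ Y →
      permBased π (termAtoms t₁ ∪ termAtoms s₁ ∪ termAtoms t₂ ∪ termAtoms s₂) →
      NAlpha (↑Δ : Set (Atom × Var)) (permTerm π t₁) t₂ →
      NAlpha (↑Δ : Set (Atom × Var)) (permTerm π s₁) s₂ →
      NStep A Δ ⟨P, (X, t₁, s₁) ::ₘ (Y, t₂, s₂) ::ₘ S, Γ, σ, V⟩
        ⟨P, (X, t₁, s₁) ::ₘ S, ctxRename Γ Y π X, updSubst σ Y (.susp π X), V⟩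

/-- The initial state of 𝔑 on the triple `X : t ≜ s`. -/
def initNState (X : Var) (t s : NTerm) (Δ : FCtx) : NState :=
  ⟨{(X, t, s)}, 0, ∅, idSubst, insert X (termVars t ∪ termVars s ∪ ctxVars Δ)⟩

/-- An `A`-based least general generalization of `p₁` and `p₂`. -/
def IsABasedLgg (A : Finset Atom) (p p₁ p₂ : TIC) : Prop :=
  ticBased p A ∧ IsGen p p₁ p₂ ∧
    ¬ ∃ p' : TIC, ticBased p' A ∧ IsGen p' p₁ p₂ ∧ TIC.Lt p p'

/-! ### The equivariance algorithm 𝔈 -/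

/-- A set of equivariance equations `t ≈ s`. -/
abbrev EProb := Multiset (NTerm × NTerm)

def eqsAtoms (E : EProb) : Finset Atom :=
  (E.map (fun e => termAtoms e.1 ∪ termAtoms e.2)).sup

def eqsVars (E : EProb) : Finset Var :=
  (E.map (fun e => termVars e.1 ∪ termVars e.2)).sup

/-- All equations of `E` are equations between atoms. -/
def AtomEqs (E : EProb) : Prop := ∀ e ∈ E, ∃ a b : Atom, e = (NTerm.atom a, NTerm.atom b)

/-- One step of the equivariance algorithm 𝔈 (with fixed freshness context `Δ`) on
states `(E; A; π)`.  The first-phase rules require `π = Id`; the second-phase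
rules require that only equations between atoms are left. -/
inductive EStep (Δ : FCtx) :
    EProb × Finset Atom × NPerm → EProb × Finset Atom × NPerm → Prop
  | dec {f : Fn} {ts ss : List NTerm} {E : EProb} {A : Finset Atom} :
      ts.length = ss.length →
      EStep Δ ((.app f ts, .app f ss) ::ₘ E, A, []) (↑(List.zip ts ss) + E, A, [])
  | alp {a b : Atom} {t s : NTerm} {E : EProb} {A : Finset Atom} (c : Atom) :
      c ∉ A → c ∉ eqsAtoms ((.abs a t, .abs b s) ::ₘ E) → c ∉ ctxAtoms Δ →
      EStep Δ ((.abs a t, .abs b s) ::ₘ E, A, [])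
        ((permTerm [(c, a)] t, permTerm [(c, b)] s) ::ₘ E, A, [])
  | sus {π₁ π₂ : NPerm} {X : Var} {E : EProb} {A : Finset Atom} :
      EStep Δ ((.susp π₁ X, .susp π₂ X) ::ₘ E, A, [])
        (↑((A.filter (fun a => (a, X) ∉ Δ)).toList.map
            (fun a => (NTerm.atom (permAtom π₁ a), NTerm.atom (permAtom π₂ a)))) + E,
         A, [])
  | rem {a b : Atom} {E : EProb} {A : Finset Atom} {π : NPerm} :
      AtomEqs ((.atom a, .atom b) ::ₘ E) → permAtom π a = b →
      EStep Δ ((.atom a, .atom b) ::ₘ E, A, π) (E, A.erase b, π)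
  | sol {a b : Atom} {E : EProb} {A : Finset Atom} {π : NPerm} :
      AtomEqs ((.atom a, .atom b) ::ₘ E) →
      permAtom π a ∈ A → b ∈ A → permAtom π a ≠ b →
      EStep Δ ((.atom a, .atom b) ::ₘ E, A, π) (E, A.erase b, (permAtom π a, b) :: π)

/-! ### Structural lemmas -/

@[elab_as_elim]
theorem NTerm.inductOnMem {P : NTerm → Prop}
    (app : ∀ f ts, (∀ t ∈ ts, P t) → P (.app f ts)) (atom : ∀ a, P (.atom a))
    (abs : ∀ a t, P t → P (.abs a t)) (susp : ∀ π X, P (.susp π X)) : ∀ t, P t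
  | .app f ts => app f ts fun t _ => NTerm.inductOnMem app atom abs susp t
  | .atom a => atom a
  | .abs a t => abs a t (NTerm.inductOnMem app atom abs susp t)
  | .susp π X => susp π X
termination_by t => sizeOf t
decreasing_by
  · have := List.sizeOf_lt_of_mem ‹_ ∈ _›
    simp_wf
    omega
  · simp_wf

@[simp] theorem permTerm_app (π : NPerm) (f : Fn) (ts : List NTerm) :
    permTerm π (.app f ts) = .app f (ts.map (permTerm π)) := by
  rw [permTerm, List.attach_map_val]

@[simp] theorem permTerm_atom (π : NPerm) (a : Atom) :
    permTerm π (.atom a) = .atom (permAtom π a) := by rw [permTerm]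

@[simp] theorem permTerm_abs (π : NPerm) (a : Atom) (t : NTerm) :
    permTerm π (.abs a t) = .abs (permAtom π a) (permTerm π t) := by rw [permTerm]

@[simp] theorem permTerm_susp (π ρ : NPerm) (X : Var) :
    permTerm π (.susp ρ X) = .susp (π ++ ρ) X := by rw [permTerm]

@[simp] theorem substTerm_app (σ : NSubst) (f : Fn) (ts : List NTerm) :
    substTerm σ (.app f ts) = .app f (ts.map (substTerm σ)) := by
  rw [substTerm, List.attach_map_val]

@[simp] theorem substTerm_atom (σ : NSubst) (a : Atom) :
    substTerm σ (.atom a) = .atom a := by rw [substTerm]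

@[simp] theorem substTerm_abs (σ : NSubst) (a : Atom) (t : NTerm) :
    substTerm σ (.abs a t) = .abs a (substTerm σ t) := by rw [substTerm]

@[simp] theorem substTerm_susp (σ : NSubst) (π : NPerm) (X : Var) :
    substTerm σ (.susp π X) = permTerm π (σ X) := by rw [substTerm]

theorem mem_foldr_union {α : Type*} (F : α → Finset Atom) (l : List α) (a : Atom) :
    a ∈ (l.map F).foldr (· ∪ ·) ∅ ↔ ∃ x ∈ l, a ∈ F x := by
  induction l <;> simp_all

theorem termBased_app {f : Fn} {ts : List NTerm} {A : Finset Atom} :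
    termBased (.app f ts) A ↔ ∀ t ∈ ts, termBased t A := by
  unfold termBased
  rw [termAtoms, List.attach_map_val]
  simp only [Finset.subset_iff, mem_foldr_union]
  grind

theorem termBased_atom {a : Atom} {A : Finset Atom} : termBased (.atom a) A ↔ a ∈ A := by
  unfold termBased; rw [termAtoms]; simp

theorem termBased_abs {a : Atom} {t : NTerm} {A : Finset Atom} :
    termBased (.abs a t) A ↔ a ∈ A ∧ termBased t A := by
  unfold termBased; rw [termAtoms]; simp [Finset.insert_subset_iff]

theorem termBased_susp {π : NPerm} {X : Var} {A : Finset Atom} :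
    termBased (.susp π X) A ↔ permAtoms π ⊆ A := by
  unfold termBased; rw [termAtoms]

/-! ### Permutations -/

theorem swapAtom_swapAtom (a b c : Atom) : swapAtom a b (swapAtom a b c) = c := by
  unfold swapAtom; grind

theorem permAtom_append (π ρ : NPerm) (c : Atom) :
    permAtom (π ++ ρ) c = permAtom π (permAtom ρ c) := by
  induction π with
  | nil => rfl
  | cons p π ih => obtain ⟨a, b⟩ := p; simp [permAtom, ih]

@[simp] theorem permAtom_permInv (π : NPerm) (c : Atom) :
    permAtom π (permAtom (permInv π) c) = c := by
  induction π generalizing c with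
  | nil => rfl
  | cons p π ih =>
    obtain ⟨a, b⟩ := p
    simp only [permInv, List.reverse_cons, permAtom_append, permAtom] at ih ⊢
    rw [ih, swapAtom_swapAtom]

@[simp] theorem permInv_permAtom (π : NPerm) (c : Atom) :
    permAtom (permInv π) (permAtom π c) = c := by
  have := permAtom_permInv (permInv π) c
  rwa [show permInv (permInv π) = π from List.reverse_reverse π] at this

theorem permAtom_injective (π : NPerm) : Function.Injective (permAtom π) :=
  Function.LeftInverse.injective (permInv_permAtom π)

theorem permAtoms_append (π ρ : NPerm) :
    permAtoms (π ++ ρ) = permAtoms π ∪ permAtoms ρ := by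
  induction π with
  | nil => simp [permAtoms]
  | cons p π ih => obtain ⟨a, b⟩ := p; simp [permAtoms, ih, Finset.insert_union]

theorem permAtoms_permInv (π : NPerm) : permAtoms (permInv π) = permAtoms π := by
  induction π with
  | nil => rfl
  | cons p π ih =>
    obtain ⟨a, b⟩ := p
    have h : permInv ((a, b) :: π) = permInv π ++ [(a, b)] := List.reverse_cons
    rw [h, permAtoms_append, ih]
    ext; simp [permAtoms]

theorem permAtom_eq_self {π : NPerm} {c : Atom} (h : c ∉ permAtoms π) : permAtom π c = c := by
  induction π with
  | nil => rfl
  | cons p π ih =>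
    obtain ⟨a, b⟩ := p
    simp only [permAtoms, Finset.mem_insert, not_or] at h
    simp [permAtom, ih h.2.2, swapAtom, h.1, h.2.1]

theorem permAtom_mem {π : NPerm} {A : Finset Atom} (hπ : permAtoms π ⊆ A) {c : Atom}
    (hc : c ∈ A) : permAtom π c ∈ A := by
  induction π with
  | nil => exact hc
  | cons p π ih =>
    obtain ⟨a, b⟩ := p
    simp only [permAtoms, Finset.insert_subset_iff] at hπ
    have := ih hπ.2.2
    simp only [permAtom, swapAtom]
    grind

theorem permAtoms_swap {a b : Atom} {A : Finset Atom} (ha : a ∈ A) (hb : b ∈ A) :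
    permAtoms [(a, b)] ⊆ A := by
  simp [permAtoms, Finset.insert_subset_iff, ha, hb]

theorem permTerm_append (π ρ : NPerm) (t : NTerm) :
    permTerm (π ++ ρ) t = permTerm π (permTerm ρ t) := by
  induction t using NTerm.inductOnMem with
  | app f ts ih => simpa using ih
  | atom a => simp [permAtom_append]
  | abs a t ih => simp [permAtom_append, ih]
  | susp ρ X => simp

theorem substTerm_permTerm (σ : NSubst) (π : NPerm) (t : NTerm) :
    substTerm σ (permTerm π t) = permTerm π (substTerm σ t) := by
  induction t using NTerm.inductOnMem with
  | app f ts ih => simpa using ih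
  | atom a => simp
  | abs a t ih => simp [ih]
  | susp ρ X => simp [permTerm_append]

theorem substTerm_substComp (σ θ : NSubst) (t : NTerm) :
    substTerm (substComp σ θ) t = substTerm θ (substTerm σ t) := by
  induction t using NTerm.inductOnMem with
  | app f ts ih => simpa using ih
  | atom a => simp
  | abs a t ih => simp [ih]
  | susp ρ X => simp [substComp, substTerm_permTerm]

theorem termBased_permTerm {π : NPerm} {A : Finset Atom} (hπ : permAtoms π ⊆ A) {t : NTerm}
    (ht : termBased t A) : termBased (permTerm π t) A := by
  induction t using NTerm.inductOnMem with
  | app f ts ih =>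
    simp only [permTerm_app, termBased_app, List.forall_mem_map] at ht ⊢
    exact fun t h => ih t h (ht t h)
  | atom a => simpa [termBased_atom] using permAtom_mem hπ (termBased_atom.1 ht)
  | abs a t ih =>
    rw [termBased_abs] at ht
    rw [permTerm_abs, termBased_abs]
    exact ⟨permAtom_mem hπ ht.1, ih ht.2⟩
  | susp ρ X =>
    rw [permTerm_susp, termBased_susp, permAtoms_append]
    exact Finset.union_subset hπ (termBased_susp.1 ht)

/-! ### Inversion of freshness -/

section
variable {S : Set (Atom × Var)}

theorem NFresh.atom_iff {a b : Atom} : NFresh S a (.atom b) ↔ a ≠ b :=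
  ⟨fun h => by cases h; assumption, .atom⟩

theorem NFresh.susp_iff {a : Atom} {π : NPerm} {X : Var} :
    NFresh S a (.susp π X) ↔ (permAtom (permInv π) a, X) ∈ S :=
  ⟨fun h => by cases h; assumption, .susp⟩

theorem NFresh.app_iff {a : Atom} {f : Fn} {ts : List NTerm} :
    NFresh S a (.app f ts) ↔ ∀ t ∈ ts, NFresh S a t :=
  ⟨fun h => by cases h; assumption, .app⟩

theorem NFresh.abs_iff {a b : Atom} {t : NTerm} :
    NFresh S a (.abs b t) ↔ a = b ∨ NFresh S a t := by
  refine ⟨fun h => ?_, fun h => ?_⟩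
  · cases h <;> simp_all
  · by_cases hab : a = b
    · subst hab; exact .abs1
    · exact .abs2 hab (h.resolve_left hab)

theorem NFresh.notMem_FAnoSusp {a : Atom} {t : NTerm} (h : NFresh S a t) :
    a ∉ FAnoSusp t := by
  induction h with
  | atom h => rw [FAnoSusp]; simpa using h
  | susp => rw [FAnoSusp]; simp
  | app _ ih => rw [FAnoSusp, List.attach_map_val, mem_foldr_union]; simpa using ih
  | abs1 => rw [FAnoSusp]; simp
  | abs2 _ _ ih => rw [FAnoSusp]; simp [ih]

/-! ### A nameless encoding that decides α-equivalence -/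

/-- Codes of nominal terms in which atoms are replaced by values of an environment. -/
inductive NCode where
  | app : Fn → List NCode → NCode
  | atom : ℕ → NCode
  | abs : NCode → NCode
  | susp : Var → (Atom → Option ℕ) → NCode

/-- The environment under a binder for `a`. -/
def pushEnv (a : Atom) (e : Atom → ℕ) : Atom → ℕ := fun b => if b = a then 0 else e b + 1

theorem pushEnv_injective {a : Atom} {e : Atom → ℕ} (he : Function.Injective e) :
    Function.Injective (pushEnv a e) := by
  intro b c h
  unfold pushEnv at h
  have := @he b c
  grind

open Classical in
/-- The code of a term in an environment; a suspension records the values of the atoms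
that are not known to be fresh for its variable. -/
noncomputable def encTerm (S : Set (Atom × Var)) (e : Atom → ℕ) : NTerm → NCode
  | .app f ts => .app f (ts.attach.map (fun x => encTerm S e x.1))
  | .atom a => .atom (e a)
  | .abs a t => .abs (encTerm S (pushEnv a e) t)
  | .susp π X => .susp X (fun a => if (a, X) ∈ S then none else some (e (permAtom π a)))
decreasing_by
  all_goals (simp_wf; try omega)
  all_goals (have := List.sizeOf_lt_of_mem x.2; omega)

@[simp] theorem encTerm_app (e : Atom → ℕ) (f : Fn) (ts : List NTerm) :
    encTerm S e (.app f ts) = .app f (ts.map (encTerm S e)) := by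
  rw [encTerm, List.attach_map_val]

@[simp] theorem encTerm_atom (e : Atom → ℕ) (a : Atom) :
    encTerm S e (.atom a) = .atom (e a) := by rw [encTerm]

@[simp] theorem encTerm_abs (e : Atom → ℕ) (a : Atom) (t : NTerm) :
    encTerm S e (.abs a t) = .abs (encTerm S (pushEnv a e) t) := by rw [encTerm]

theorem encTerm_susp_eq_iff {e e' : Atom → ℕ} {π π' : NPerm} {X Y : Var} :
    encTerm S e (.susp π X) = encTerm S e' (.susp π' Y) ↔
      X = Y ∧ ∀ a, (a, X) ∉ S → e (permAtom π a) = e' (permAtom π' a) := by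
  rw [encTerm, encTerm, NCode.susp.injEq]
  refine and_congr_right ?_
  rintro rfl
  rw [funext_iff]
  refine forall_congr' fun a => ?_
  by_cases h : (a, X) ∈ S <;> simp [h]

theorem encTerm_permTerm (e : Atom → ℕ) (π : NPerm) (t : NTerm) :
    encTerm S e (permTerm π t) = encTerm S (fun a => e (permAtom π a)) t := by
  induction t using NTerm.inductOnMem generalizing e with
  | app f ts ih => simpa using fun t ht => ih t ht e
  | atom a => simp
  | abs a t ih =>
    simp only [permTerm_abs, encTerm_abs, ih]
    congr 2
    funext b
    simp [pushEnv, (permAtom_injective π).eq_iff]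
  | susp ρ X => simp [encTerm_susp_eq_iff, permAtom_append]

theorem encTerm_eq_iff {e e' : Atom → ℕ} {t : NTerm} :
    encTerm S e t = encTerm S e' t ↔ ∀ a, e a ≠ e' a → NFresh S a t := by
  induction t using NTerm.inductOnMem generalizing e e' with
  | app f ts ih =>
    simp only [encTerm_app, NCode.app.injEq, true_and, List.map_inj_left, NFresh.app_iff]
    exact ⟨fun h a ha t ht => (ih t ht).1 (h t ht) a ha,
      fun h t ht => (ih t ht).2 fun a ha => h a ha t ht⟩
  | atom b =>
    simp only [encTerm_atom, NCode.atom.injEq, NFresh.atom_iff]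
    exact ⟨fun h a ha hab => ha (hab ▸ h), fun h => by_contra fun hb => h b hb rfl⟩
  | abs b t ih =>
    simp only [encTerm_abs, NCode.abs.injEq, ih, NFresh.abs_iff, pushEnv]
    refine forall_congr' fun a => ?_
    by_cases h : a = b <;> simp [h]
  | susp π X =>
    simp only [encTerm_susp_eq_iff, true_and, NFresh.susp_iff]
    refine ⟨fun h a ha => by_contra fun hS => ha ?_, fun h a ha => by_contra fun hS => ha ?_⟩
    · simpa using h _ hS
    · simpa using h _ hS

theorem NFresh.of_encTerm_eq {e e' : Atom → ℕ} {t s : NTerm} {a : Atom}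
    (h : encTerm S e t = encTerm S e' s) (ha : ∀ b, e' b ≠ e a) : NFresh S a t := by
  induction t using NTerm.inductOnMem generalizing e e' s with
  | app f ts ih =>
    cases s with
    | app g ss =>
      simp only [encTerm_app, NCode.app.injEq] at h
      refine .app fun t ht => ?_
      have hm : encTerm S e t ∈ ss.map (encTerm S e') := h.2 ▸ List.mem_map_of_mem ht
      obtain ⟨s, -, hs⟩ := List.mem_map.1 hm
      exact ih t ht hs.symm ha
    | _ => simp [encTerm] at h
  | atom b =>
    cases s with
    | atom c =>
      simp only [encTerm_atom, NCode.atom.injEq] at h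
      exact .atom fun hab => ha c (by rw [hab, h])
    | _ => simp [encTerm] at h
  | abs b t ih =>
    cases s with
    | abs c s =>
      simp only [encTerm_abs, NCode.abs.injEq] at h
      rw [NFresh.abs_iff]
      refine or_iff_not_imp_left.2 fun hab => ih h fun d => ?_
      have := ha d
      simp only [pushEnv, hab, if_false]
      split <;> omega
    | _ => simp [encTerm] at h
  | susp π X =>
    cases s with
    | susp ρ Y =>
      rw [encTerm_susp_eq_iff] at h
      exact .susp (by_contra fun hS => ha _ (by simpa using (h.2 _ hS).symm))
    | _ => simp [encTerm] at h

theorem NAlpha.app_iff {f g : Fn} {ts ss : List NTerm} :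
    NAlpha S (.app f ts) (.app g ss) ↔ f = g ∧ List.Forall₂ (NAlpha S) ts ss := by
  rw [List.forall₂_iff_zip]
  refine ⟨fun h => ?_, ?_⟩
  · cases h with
    | app hl h => exact ⟨rfl, hl, fun hab => h _ hab⟩
  · rintro ⟨rfl, hl, h⟩
    exact .app hl fun p hp => h hp

theorem NAlpha.encTerm_eq {t s : NTerm} (h : NAlpha S t s) (e : Atom → ℕ) :
    encTerm S e t = encTerm S e s := by
  induction h generalizing e with
  | atom => rfl
  | abs1 _ ih => simp [ih]
  | @abs2 a b t s hab _ hf ih =>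
    rw [encTerm_abs, encTerm_abs, ih, encTerm_permTerm]
    congr 1
    refine encTerm_eq_iff.2 fun c hc => ?_
    have hca : c = a := by
      by_contra hca
      simp only [permAtom, pushEnv, swapAtom] at hc
      grind
    exact hca ▸ hf
  | susp h =>
    exact encTerm_susp_eq_iff.2 ⟨rfl, fun a ha =>
      congrArg e (by_contra fun hne => ha (h a hne))⟩
  | @app f ts ss hl h ih =>
    simp only [encTerm_app, NCode.app.injEq, true_and]
    rw [← List.forall₂_eq_eq_eq, List.forall₂_map_left_iff, List.forall₂_map_right_iff,
      List.forall₂_iff_zip]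
    exact ⟨hl, fun hp => ih _ hp e⟩

theorem NAlpha.of_encTerm_eq {e : Atom → ℕ} (he : Function.Injective e) {t s : NTerm}
    (h : encTerm S e t = encTerm S e s) : NAlpha S t s := by
  induction t using NTerm.inductOnMem generalizing e s with
  | app f ts ih =>
    cases s with
    | app g ss =>
      simp only [encTerm_app, NCode.app.injEq] at h
      obtain ⟨rfl, h⟩ := h
      rw [← List.forall₂_eq_eq_eq, List.forall₂_map_left_iff, List.forall₂_map_right_iff,
        List.forall₂_iff_zip] at h
      exact .app h.1 fun p hp => ih _ (List.of_mem_zip hp).1 he (h.2 hp)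
    | _ => simp [encTerm] at h
  | atom b =>
    cases s with
    | atom c =>
      simp only [encTerm_atom, NCode.atom.injEq] at h
      exact he h ▸ .atom b
    | _ => simp [encTerm] at h
  | abs a t ih =>
    cases s with
    | abs b s =>
      simp only [encTerm_abs, NCode.abs.injEq] at h
      by_cases hab : a = b
      · subst hab
        exact .abs1 (ih (pushEnv_injective he) h)
      · have hf : NFresh S a s := by
          refine .of_encTerm_eq h.symm fun c => ?_
          have := @he c a
          simp only [pushEnv, hab, if_false]
          grind
        refine .abs2 hab (ih (pushEnv_injective (a := a) he) ?_) hf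
        rw [h, encTerm_permTerm]
        refine encTerm_eq_iff.2 fun c hc => ?_
        have hca : c = a := by
          by_contra hca
          simp only [permAtom, pushEnv, swapAtom] at hc
          grind
        exact hca ▸ hf
    | _ => simp [encTerm] at h
  | susp π X =>
    cases s with
    | susp ρ Y =>
      rw [encTerm_susp_eq_iff] at h
      obtain ⟨rfl, h⟩ := h
      exact .susp fun a ha => by_contra fun hS => ha (he (h a hS))
    | _ => simp [encTerm] at h

/-! ### Properties of α-equivalence -/

theorem NAlpha.iff_encTerm_eq {t s : NTerm} :
    NAlpha S t s ↔ encTerm S id t = encTerm S id s :=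
  ⟨fun h => h.encTerm_eq id, .of_encTerm_eq Function.injective_id⟩

theorem NAlpha.refl (t : NTerm) : NAlpha S t t := iff_encTerm_eq.2 rfl

theorem NAlpha.symm {t s : NTerm} (h : NAlpha S t s) : NAlpha S s t :=
  iff_encTerm_eq.2 (iff_encTerm_eq.1 h).symm

theorem NAlpha.trans {t s u : NTerm} (h : NAlpha S t s) (h' : NAlpha S s u) : NAlpha S t u :=
  iff_encTerm_eq.2 ((iff_encTerm_eq.1 h).trans (iff_encTerm_eq.1 h'))

theorem NAlpha.perm {t s : NTerm} (h : NAlpha S t s) (π : NPerm) :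
    NAlpha S (permTerm π t) (permTerm π s) := by
  rw [iff_encTerm_eq, encTerm_permTerm, encTerm_permTerm]
  exact h.encTerm_eq _

theorem NAlpha.permTerm_iff {π ρ : NPerm} {t : NTerm} :
    NAlpha S (permTerm π t) (permTerm ρ t) ↔
      ∀ a, permAtom π a ≠ permAtom ρ a → NFresh S a t := by
  rw [iff_encTerm_eq, encTerm_permTerm, encTerm_permTerm, encTerm_eq_iff]
  rfl

theorem NAlpha.permTerm_congr {π ρ : NPerm} (h : ∀ a, permAtom π a = permAtom ρ a)
    (t : NTerm) : NAlpha S (permTerm π t) (permTerm ρ t) :=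
  permTerm_iff.2 fun a ha => absurd (h a) ha

theorem NAlpha.permTerm_self {π : NPerm} (h : ∀ a, permAtom π a = a) (t : NTerm) :
    NAlpha S (permTerm π t) t := by
  rw [iff_encTerm_eq, encTerm_permTerm]
  simp only [h]

theorem NAlpha.permInv_left {π : NPerm} {t s : NTerm} (h : NAlpha S (permTerm π t) s) :
    NAlpha S (permTerm (permInv π) s) t := by
  refine (h.symm.perm _).trans ?_
  rw [← permTerm_append]
  exact permTerm_self (fun a => by simp [permAtom_append]) t

theorem NFresh.perm {a : Atom} {t : NTerm} (h : NFresh S a t) (π : NPerm) :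
    NFresh S (permAtom π a) (permTerm π t) := by
  induction h with
  | atom h => simpa [NFresh.atom_iff, (permAtom_injective π).eq_iff] using h
  | @susp ρ X h =>
    rw [permTerm_susp, NFresh.susp_iff]
    have : permInv (π ++ ρ) = permInv ρ ++ permInv π := List.reverse_append
    simpa [this, permAtom_append] using h
  | app _ ih => simpa [NFresh.app_iff] using ih
  | abs1 => rw [permTerm_abs]; exact .abs1
  | abs2 hab _ ih => rw [permTerm_abs]; exact .abs2 ((permAtom_injective π).ne hab) ih

theorem NFresh.alpha {a : Atom} {t s : NTerm} (h : NFresh S a t) (hts : NAlpha S t s) :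
    NFresh S a s := by
  have hs : encTerm S (fun b => b + 1) s = encTerm S (pushEnv a id) s := by
    rw [← hts.encTerm_eq, ← hts.encTerm_eq, encTerm_eq_iff]
    intro b hb
    by_cases hba : b = a
    · exact hba ▸ h
    · exact absurd (by simp [pushEnv, hba]) hb
  exact encTerm_eq_iff.1 hs a (by simp [pushEnv])

theorem NAlpha.abs_iff {a b : Atom} {t s : NTerm} :
    NAlpha S (.abs a t) (.abs b s) ↔
      NAlpha S (permTerm [(a, b)] t) s ∧ (a = b ∨ NFresh S a s) := by
  have key : ∀ u : NTerm, NAlpha S (permTerm [(a, b)] (permTerm [(a, b)] u)) u := fun u => by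
    rw [← permTerm_append]
    exact permTerm_self (fun c => by simp [permAtom, swapAtom_swapAtom]) u
  have hid : ∀ u : NTerm, NAlpha S (permTerm [(a, a)] u) u := permTerm_self fun c => by
    simp only [permAtom, swapAtom]; grind
  refine ⟨fun h => ?_, fun ⟨h, hf⟩ => ?_⟩
  · cases h with
    | abs1 h => exact ⟨(hid t).trans h, .inl rfl⟩
    | abs2 _ h hf => exact ⟨(h.perm _).trans (key s), .inr hf⟩
  · by_cases hab : a = b
    · subst hab
      exact .abs1 ((hid t).symm.trans h)
    · exact .abs2 hab ((key t).symm.trans (h.perm _)) (hf.resolve_left hab)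

theorem NAlpha.abs_rename {a c : Atom} {t : NTerm} (h : NFresh S c (.abs a t)) :
    NAlpha S (.abs a t) (.abs c (permTerm [(c, a)] t)) := by
  rw [abs_iff]
  refine ⟨permTerm_congr (fun b => by simp only [permAtom, swapAtom]; grind) t, ?_⟩
  refine or_iff_not_imp_left.2 fun hac => ?_
  have := ((NFresh.abs_iff.1 h).resolve_left (Ne.symm hac)).perm [(c, a)]
  simpa [permAtom, swapAtom] using this

/-! ### Monotonicity, finiteness and substitution -/

theorem NFresh.mono {S' : Set (Atom × Var)} (hS : S ⊆ S') {a : Atom} {t : NTerm}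
    (h : NFresh S a t) : NFresh S' a t := by
  induction h with
  | atom h => exact .atom h
  | susp h => exact .susp (hS h)
  | app _ ih => exact .app ih
  | abs1 => exact .abs1
  | abs2 hab _ ih => exact .abs2 hab ih

theorem NAlpha.mono {S' : Set (Atom × Var)} (hS : S ⊆ S') {t s : NTerm}
    (h : NAlpha S t s) : NAlpha S' t s := by
  induction h with
  | atom a => exact .atom a
  | abs1 _ ih => exact .abs1 ih
  | abs2 hab _ hf ih => exact .abs2 hab ih (hf.mono hS)
  | susp h => exact .susp fun a ha => hS (h a ha)
  | app hl _ ih => exact .app hl ih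

theorem exists_finset_forall_mem_list {α β : Type*} [DecidableEq β] {T : Set β}
    {Q : Set β → α → Prop} (hQ : ∀ S S' a, S ⊆ S' → Q S a → Q S' a) (l : List α)
    (h : ∀ a ∈ l, ∃ F : Finset β, (F : Set β) ⊆ T ∧ Q F a) :
    ∃ F : Finset β, (F : Set β) ⊆ T ∧ ∀ a ∈ l, Q F a := by
  induction l with
  | nil => exact ⟨∅, by simp, by simp⟩
  | cons a l ih =>
    obtain ⟨F, hF, ha⟩ := h a (by simp)
    obtain ⟨G, hG, hl⟩ := ih fun b hb => h b (by simp [hb])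
    refine ⟨F ∪ G, by simp [hF, hG], ?_⟩
    intro b hb
    rcases List.mem_cons.1 hb with rfl | hb
    · exact hQ _ _ _ (by simp) ha
    · exact hQ _ _ _ (by simp) (hl b hb)

theorem NFresh.exists_finset {a : Atom} {t : NTerm} (h : NFresh S a t) :
    ∃ F : FCtx, (F : Set (Atom × Var)) ⊆ S ∧ NFresh (F : Set (Atom × Var)) a t := by
  induction h with
  | atom h => exact ⟨∅, by simp, .atom h⟩
  | @susp π X h => exact ⟨{(permAtom (permInv π) _, X)}, by simpa using h, .susp (by simp)⟩
  | @app f ts _ ih =>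
    obtain ⟨F, hF, h⟩ := exists_finset_forall_mem_list
      (Q := fun S t => NFresh S a t) (fun _ _ _ h => NFresh.mono h) _ ih
    exact ⟨F, hF, .app h⟩
  | abs1 => exact ⟨∅, by simp, .abs1⟩
  | abs2 hab _ ih =>
    obtain ⟨F, hF, h⟩ := ih
    exact ⟨F, hF, .abs2 hab h⟩

theorem NAlpha.exists_finset {t s : NTerm} (h : NAlpha S t s) :
    ∃ F : FCtx, (F : Set (Atom × Var)) ⊆ S ∧ NAlpha (F : Set (Atom × Var)) t s := by
  induction h with
  | atom a => exact ⟨∅, by simp, .atom a⟩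
  | abs1 _ ih =>
    obtain ⟨F, hF, h⟩ := ih
    exact ⟨F, hF, .abs1 h⟩
  | abs2 hab _ hf ih =>
    obtain ⟨F, hF, h⟩ := ih
    obtain ⟨G, hG, h'⟩ := hf.exists_finset
    exact ⟨F ∪ G, by simp [hF, hG],
      .abs2 hab (h.mono (by simp)) (h'.mono (by simp))⟩
  | @susp π ρ X h =>
    refine ⟨((permAtoms π ∪ permAtoms ρ).filter
      fun a => permAtom π a ≠ permAtom ρ a).image fun a => (a, X), ?_, .susp fun a ha => ?_⟩
    · rintro ⟨a, Y⟩ hY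
      simp only [Finset.coe_image, Finset.coe_filter, Set.mem_image, Set.mem_ofPred_eq,
        Prod.mk.injEq] at hY
      obtain ⟨b, ⟨-, hb⟩, rfl, rfl⟩ := hY
      exact h _ hb
    · simp only [Finset.coe_image, Finset.coe_filter, Set.mem_image, Set.mem_ofPred_eq]
      refine ⟨a, ⟨by_contra fun hn => ha ?_, ha⟩, rfl⟩
      simp only [Finset.mem_union, not_or] at hn
      rw [permAtom_eq_self hn.1, permAtom_eq_self hn.2]
  | @app f ts ss hl _ ih =>
    obtain ⟨F, hF, h⟩ := exists_finset_forall_mem_list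
      (Q := fun S (p : NTerm × NTerm) => NAlpha S p.1 p.2) (fun _ _ _ h => NAlpha.mono h) _ ih
    exact ⟨F, hF, .app hl h⟩

theorem NFresh.of_perm {π : NPerm} {a : Atom} {t : NTerm}
    (h : NFresh S (permAtom (permInv π) a) t) : NFresh S a (permTerm π t) := by
  simpa using h.perm π

theorem NFresh.subst {S' : Set (Atom × Var)} {σ : NSubst}
    (hσ : ∀ c ∈ S, NFresh S' c.1 (σ c.2)) {a : Atom} {t : NTerm} (h : NFresh S a t) :
    NFresh S' a (substTerm σ t) := by
  induction h with
  | atom h => simpa using .atom h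
  | susp h => simpa using (hσ _ h).of_perm
  | app _ ih => simpa [NFresh.app_iff] using ih
  | abs1 => simpa using .abs1
  | abs2 hab _ ih => simpa using .abs2 hab ih

theorem NAlpha.subst {S' : Set (Atom × Var)} {σ : NSubst}
    (hσ : ∀ c ∈ S, NFresh S' c.1 (σ c.2)) {t s : NTerm} (h : NAlpha S t s) :
    NAlpha S' (substTerm σ t) (substTerm σ s) := by
  induction h with
  | atom a => simpa using .atom a
  | abs1 _ ih => simpa using .abs1 ih
  | abs2 hab _ hf ih =>
    rw [substTerm_permTerm] at ih
    simpa using .abs2 hab ih (hf.subst hσ)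
  | susp h => simpa using permTerm_iff.2 fun a ha => hσ _ (h a ha)
  | @app f ts ss hl _ ih =>
    rw [substTerm_app, substTerm_app, app_iff, List.forall₂_map_left_iff,
      List.forall₂_map_right_iff, List.forall₂_iff_zip]
    exact ⟨rfl, hl, fun hp => ih _ hp⟩

end

/-! ### Depth bounds -/

/-- `DepthLE n t` holds when the syntax tree of `t` has at most `n` levels. -/
def DepthLE : ℕ → NTerm → Prop
  | 0, _ => False
  | n + 1, .app _ ts => ∀ t ∈ ts, DepthLE n t
  | n + 1, .abs _ t => DepthLE n t
  | _ + 1, .atom _ => True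
  | _ + 1, .susp _ _ => True

theorem DepthLE.succ {n : ℕ} {t : NTerm} (h : DepthLE n t) : DepthLE (n + 1) t := by
  induction n generalizing t with
  | zero => exact h.elim
  | succ n ih =>
    cases t with
    | app f ts => exact fun t ht => ih (h t ht)
    | abs a t => exact ih (t := t) h
    | _ => trivial

theorem DepthLE.mono {n m : ℕ} (hnm : n ≤ m) {t : NTerm} (h : DepthLE n t) : DepthLE m t := by
  induction hnm with
  | refl => exact h
  | step _ ih => exact ih.succ

theorem DepthLE.permTerm {n : ℕ} {t : NTerm} (h : DepthLE n t) (π : NPerm) :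
    DepthLE n (permTerm π t) := by
  induction n generalizing t with
  | zero => exact h.elim
  | succ n ih =>
    cases t with
    | app f ts =>
      rw [permTerm_app]
      simp only [DepthLE, List.forall_mem_map] at h ⊢
      exact fun t ht => ih (h t ht)
    | abs a t =>
      rw [permTerm_abs]
      exact ih (t := t) h
    | atom a => rw [permTerm_atom]; trivial
    | susp ρ X => rw [permTerm_susp]; trivial

theorem exists_depthLE (t : NTerm) : ∃ n, DepthLE n t := by
  induction t using NTerm.inductOnMem with
  | app f ts ih =>
    have : ∃ n, ∀ t ∈ ts, DepthLE n t := by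
      clear f
      induction ts with
      | nil => exact ⟨0, by simp⟩
      | cons t ts ih' =>
        obtain ⟨n, hn⟩ := ih t (by simp)
        obtain ⟨m, hm⟩ := ih' fun s hs => ih s (by simp [hs])
        refine ⟨max n m, fun s hs => ?_⟩
        rcases List.mem_cons.1 hs with rfl | hs
        · exact hn.mono (le_max_left _ _)
        · exact (hm s hs).mono (le_max_right _ _)
    obtain ⟨n, hn⟩ := this
    exact ⟨n + 1, hn⟩
  | atom a => exact ⟨1, trivial⟩
  | abs a t ih =>
    obtain ⟨n, hn⟩ := ih
    exact ⟨n + 1, hn⟩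
  | susp π X => exact ⟨1, trivial⟩

/-! ### Variables naming pairs of terms -/

/-- An injective numbering of terms. -/
def termCode : NTerm → ℕ
  | .app f ts => Encodable.encode (0, f, ts.attach.map (fun x => termCode x.1))
  | .atom a => Encodable.encode (1, a, ([] : List ℕ))
  | .abs a t => Encodable.encode (2, a, [termCode t])
  | .susp π X => Encodable.encode (3, X, [Encodable.encode π])
decreasing_by
  all_goals (simp_wf; try omega)
  all_goals (have := List.sizeOf_lt_of_mem x.2; omega)

theorem termCode_injective : Function.Injective termCode := by
  intro t s h
  induction t using NTerm.inductOnMem generalizing s with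
  | app f ts ih =>
    cases s with
    | app g ss =>
      rw [termCode, termCode, List.attach_map_val, List.attach_map_val] at h
      replace h := Encodable.encode_injective h
      simp only [Prod.mk.injEq, true_and] at h
      obtain ⟨rfl, h⟩ := h
      congr 1
      rw [← List.forall₂_eq_eq_eq, List.forall₂_map_left_iff, List.forall₂_map_right_iff,
        List.forall₂_iff_zip] at h
      rw [← List.forall₂_eq_eq_eq, List.forall₂_iff_zip]
      exact ⟨h.1, fun hp => ih _ (List.of_mem_zip hp).1 (h.2 hp)⟩
    | _ =>
      rw [termCode, termCode] at h
      simpa using Encodable.encode_injective h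
  | atom a =>
    cases s with
    | atom b =>
      rw [termCode, termCode] at h
      simpa using Encodable.encode_injective h
    | _ =>
      rw [termCode, termCode] at h
      simpa using Encodable.encode_injective h
  | abs a t ih =>
    cases s with
    | abs b s =>
      rw [termCode, termCode] at h
      replace h := Encodable.encode_injective h
      simp only [Prod.mk.injEq, List.cons.injEq, true_and, and_true] at h
      rw [h.1, ih h.2]
    | _ =>
      rw [termCode, termCode] at h
      simpa using Encodable.encode_injective h
  | susp π X =>
    cases s with
    | susp ρ Y =>
      rw [termCode, termCode] at h
      replace h := Encodable.encode_injective h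
      simp only [Prod.mk.injEq, List.cons.injEq, true_and, and_true] at h
      rw [h.1, Encodable.encode_injective h.2]
    | _ =>
      rw [termCode, termCode] at h
      simpa using Encodable.encode_injective h

/-- The variable naming a pair of terms. -/
def pairVar (p : NTerm × NTerm) : Var := Nat.pair (termCode p.1) (termCode p.2)

theorem pairVar_injective : Function.Injective pairVar := by
  intro p q h
  have h := Nat.pair_eq_pair.1 h
  exact Prod.ext (termCode_injective h.1) (termCode_injective h.2)

instance : Nonempty NTerm := ⟨.atom 0⟩

/-- The pair of terms named by a variable. -/
noncomputable def varPair : Var → NTerm × NTerm := Function.invFun pairVar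

@[simp] theorem varPair_pairVar (p : NTerm × NTerm) : varPair (pairVar p) = p :=
  Function.leftInverse_invFun pairVar_injective p

/-! ### The canonical generalization -/

section
variable (A : Finset Atom) (S : Set (Atom × Var))

/-- Pairs of terms that agree up to `≈` and a permutation of the atoms in `A`. -/
def pairSetoid : Setoid (NTerm × NTerm) where
  r p q := ∃ π, permAtoms π ⊆ A ∧ NAlpha S (permTerm π p.1) q.1 ∧ NAlpha S (permTerm π p.2) q.2
  iseqv :=
    { refl := fun p => ⟨[], by simp [permAtoms],
        .permTerm_self (fun _ => rfl) _, .permTerm_self (fun _ => rfl) _⟩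
      symm := fun ⟨π, hπ, h, h'⟩ =>
        ⟨permInv π, by rwa [permAtoms_permInv], h.permInv_left, h'.permInv_left⟩
      trans := fun ⟨π, hπ, h, h'⟩ ⟨ρ, hρ, k, k'⟩ =>
        ⟨ρ ++ π, by rw [permAtoms_append]; exact Finset.union_subset hρ hπ,
          by rw [permTerm_append]; exact (h.perm ρ).trans k,
          by rw [permTerm_append]; exact (h'.perm ρ).trans k'⟩ }

/-- A representative of the class of a pair. -/
noncomputable def pairRep (p : NTerm × NTerm) : NTerm × NTerm :=
  (Quotient.mk (pairSetoid A S) p).out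

theorem pairRep_eq {p q : NTerm × NTerm} (h : pairSetoid A S p q) :
    pairRep A S p = pairRep A S q :=
  congrArg Quotient.out (Quotient.sound (s := pairSetoid A S) h)

theorem exists_perm_pairRep (p : NTerm × NTerm) :
    ∃ π, permAtoms π ⊆ A ∧ NAlpha S (permTerm π (pairRep A S p).1) p.1 ∧
      NAlpha S (permTerm π (pairRep A S p).2) p.2 :=
  Quotient.mk_out (s := pairSetoid A S) p

/-- A permutation carrying the representative of a pair to the pair itself. -/
noncomputable def pairPerm (p : NTerm × NTerm) : NPerm := (exists_perm_pairRep A S p).choose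

/-- The suspension generalizing a pair of terms. -/
noncomputable def genLeaf (t s : NTerm) : NTerm :=
  .susp (pairPerm A S (t, s)) (pairVar (pairRep A S (t, s)))

/-- All constraints satisfied by the pairs which the variables name. -/
def pairCtx : Set (Atom × Var) :=
  {c | c.1 ∈ A ∧ NFresh S c.1 (varPair c.2).1 ∧ NFresh S c.1 (varPair c.2).2}

open Classical in
/-- The canonical `A`-based generalization of two terms, explored up to a given depth. -/
noncomputable def genTerm : ℕ → NTerm → NTerm → NTerm
  | 0, t, s => genLeaf A S t s
  | n + 1, .app f ts, .app g ss =>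
    if f = g ∧ ts.length = ss.length then .app f (List.zipWith (genTerm n) ts ss)
    else genLeaf A S (.app f ts) (.app g ss)
  | _ + 1, .atom a, .atom b =>
    if a = b then .atom a else genLeaf A S (.atom a) (.atom b)
  | n + 1, .abs a t, .abs b s =>
    if h : ∃ c ∈ A, NFresh S c (.abs a t) ∧ NFresh S c (.abs b s) then
      .abs h.choose (genTerm n (permTerm [(h.choose, a)] t) (permTerm [(h.choose, b)] s))
    else genLeaf A S (.abs a t) (.abs b s)
  | _ + 1, t, s => genLeaf A S t s

variable {A S}

/-- The possible shapes of a canonical generalization. -/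
theorem genTerm_cases {n : ℕ} {t s : NTerm} {P : NTerm → Prop}
    (leaf : P (genLeaf A S t s))
    (app : ∀ m f ts ss, n = m + 1 → t = .app f ts → s = .app f ss → ts.length = ss.length →
      P (.app f (List.zipWith (genTerm A S m) ts ss)))
    (atom : ∀ m a, n = m + 1 → t = .atom a → s = .atom a → P (.atom a))
    (abs : ∀ m a b c t' s', n = m + 1 → t = .abs a t' → s = .abs b s' → c ∈ A →
      NFresh S c t → NFresh S c s →
      P (.abs c (genTerm A S m (permTerm [(c, a)] t') (permTerm [(c, b)] s')))) :
    P (genTerm A S n t s) := by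
  cases n with
  | zero => exact leaf
  | succ n =>
    cases t <;> cases s
    case app.app f ts g ss =>
      rw [genTerm]
      split_ifs with h
      · obtain ⟨rfl, h⟩ := h
        exact app n _ ts ss rfl rfl rfl h
      · exact leaf
    case atom.atom a b =>
      rw [genTerm]
      split_ifs with h
      · subst h
        exact atom n a rfl rfl rfl
      · exact leaf
    case abs.abs a t b s =>
      rw [genTerm]
      split_ifs with h
      · exact abs n a b _ t s rfl rfl rfl h.choose_spec.1 h.choose_spec.2.1 h.choose_spec.2.2
      · exact leaf
    all_goals exact leaf

theorem genTerm_app (n : ℕ) (f : Fn) {ts ss : List NTerm} (h : ts.length = ss.length) :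
    genTerm A S (n + 1) (.app f ts) (.app f ss) =
      .app f (List.zipWith (genTerm A S n) ts ss) := by
  rw [genTerm, if_pos ⟨rfl, h⟩]

theorem genTerm_abs (n : ℕ) {a b : Atom} {t s : NTerm}
    (h : ∃ c ∈ A, NFresh S c (.abs a t) ∧ NFresh S c (.abs b s)) :
    ∃ c ∈ A, NFresh S c (.abs a t) ∧ NFresh S c (.abs b s) ∧
      genTerm A S (n + 1) (.abs a t) (.abs b s) =
        .abs c (genTerm A S n (permTerm [(c, a)] t) (permTerm [(c, b)] s)) :=
  ⟨h.choose, h.choose_spec.1, h.choose_spec.2.1, h.choose_spec.2.2, by rw [genTerm, dif_pos h]⟩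

theorem pairPerm_spec (p : NTerm × NTerm) :
    permAtoms (pairPerm A S p) ⊆ A ∧
      NAlpha S (permTerm (pairPerm A S p) (pairRep A S p).1) p.1 ∧
      NAlpha S (permTerm (pairPerm A S p) (pairRep A S p).2) p.2 :=
  (exists_perm_pairRep A S p).choose_spec

theorem termBased_genTerm {n : ℕ} {t s : NTerm} (ht : termBased t A) :
    termBased (genTerm A S n t s) A := by
  induction n generalizing t s with
  | zero => exact termBased_susp.2 (pairPerm_spec _).1
  | succ n ih =>
    refine genTerm_cases (P := fun u => termBased u A)
      (termBased_susp.2 (pairPerm_spec _).1) ?_ ?_ ?_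
    · rintro m f ts ss hm rfl - -
      obtain rfl := Nat.succ.inj hm
      rw [termBased_app] at ht ⊢
      intro u hu
      rw [← List.map_uncurry_zip_eq_zipWith, List.mem_map] at hu
      obtain ⟨p, hp, rfl⟩ := hu
      exact ih (ht _ (List.of_mem_zip hp).1)
    · rintro m a - rfl -
      exact ht
    · rintro m a b c t' s' hm rfl - hc - -
      obtain rfl := Nat.succ.inj hm
      rw [termBased_abs] at ht ⊢
      exact ⟨hc, ih (termBased_permTerm (permAtoms_swap hc ht.1) ht.2)⟩

theorem NFresh.genTerm {n : ℕ} {a : Atom} {t s : NTerm} (ha : a ∈ A) (ht : NFresh S a t)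
    (hs : NFresh S a s) : NFresh (pairCtx A S) a (genTerm A S n t s) := by
  have leaf : ∀ {t s}, NFresh S a t → NFresh S a s →
      NFresh (pairCtx A S) a (genLeaf A S t s) := by
    intro t s ht hs
    obtain ⟨h, ht', hs'⟩ := pairPerm_spec (A := A) (S := S) (t, s)
    refine .susp ⟨permAtom_mem (by rwa [permAtoms_permInv]) ha, ?_, ?_⟩
    · simpa using (ht.perm _).alpha ht'.permInv_left
    · simpa using (hs.perm _).alpha hs'.permInv_left
  induction n generalizing t s with
  | zero => exact leaf ht hs
  | succ n ih =>
    refine genTerm_cases (P := NFresh (pairCtx A S) a) (leaf ht hs) ?_ ?_ ?_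
    · rintro m f ts ss hm rfl rfl -
      obtain rfl := Nat.succ.inj hm
      rw [NFresh.app_iff] at ht hs ⊢
      intro u hu
      rw [← List.map_uncurry_zip_eq_zipWith, List.mem_map] at hu
      obtain ⟨p, hp, rfl⟩ := hu
      exact ih (ht _ (List.of_mem_zip hp).1) (hs _ (List.of_mem_zip hp).2)
    · rintro m b - rfl -
      exact .atom (NFresh.atom_iff.1 ht)
    · rintro m b b' c t' s' hm rfl rfl hc hct hcs
      obtain rfl := Nat.succ.inj hm
      have h1 := NFresh.abs_iff.1 (ht.alpha (NAlpha.abs_rename hct))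
      have h2 := NFresh.abs_iff.1 (hs.alpha (NAlpha.abs_rename hcs))
      rw [NFresh.abs_iff]
      exact or_iff_not_imp_left.2 fun hac =>
        ih (h1.resolve_left hac) (h2.resolve_left hac)

theorem NAlpha.genLeaf_congr {π : NPerm} (hπ : permAtoms π ⊆ A) {t s t' s' : NTerm}
    (ht : NAlpha S (permTerm π t) t') (hs : NAlpha S (permTerm π s) s') :
    NAlpha (pairCtx A S) (permTerm π (genLeaf A S t s)) (genLeaf A S t' s') := by
  have hrep : pairRep A S (t, s) = pairRep A S (t', s') := pairRep_eq A S ⟨π, hπ, ht, hs⟩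
  obtain ⟨h, k, l⟩ := pairPerm_spec (A := A) (S := S) (t, s)
  obtain ⟨h', k', l'⟩ := pairPerm_spec (A := A) (S := S) (t', s')
  unfold genLeaf
  rw [permTerm_susp, hrep]
  rw [hrep] at k l
  refine .susp fun a ha => ⟨by_contra fun haA => ha ?_, ?_, ?_⟩
  · rw [permAtom_append, permAtom_eq_self fun hm => haA (h hm),
      permAtom_eq_self fun hm => haA (hπ hm), permAtom_eq_self fun hm => haA (h' hm)]
  · simp only [varPair_pairVar]
    refine NAlpha.permTerm_iff.1 ?_ a ha
    rw [permTerm_append]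
    exact ((k.perm π).trans ht).trans k'.symm
  · simp only [varPair_pairVar]
    refine NAlpha.permTerm_iff.1 ?_ a ha
    rw [permTerm_append]
    exact ((l.perm π).trans hs).trans l'.symm

theorem NAlpha.abs_genTerm_congr {n m : ℕ} {t s t' s' : NTerm}
    (congr : ∀ π, permAtoms π ⊆ A → NAlpha S (permTerm π t) t' → NAlpha S (permTerm π s) s' →
      NAlpha (pairCtx A S) (permTerm π (genTerm A S n t s)) (genTerm A S m t' s'))
    {π : NPerm} (hπ : permAtoms π ⊆ A) {c d : Atom} (hc : c ∈ A) (hd : d ∈ A)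
    (ht : NAlpha S (.abs d (permTerm π t)) (.abs c t'))
    (hs : NAlpha S (.abs d (permTerm π s)) (.abs c s')) :
    NAlpha (pairCtx A S) (.abs d (permTerm π (genTerm A S n t s)))
      (.abs c (genTerm A S m t' s')) := by
  rw [NAlpha.abs_iff, ← permTerm_append] at ht hs ⊢
  refine ⟨congr _ ?_ ht.1 hs.1, or_iff_not_imp_left.2 fun hdc => ?_⟩
  · rw [permAtoms_append]
    exact Finset.union_subset (permAtoms_swap hd hc) hπ
  · exact .genTerm hd (ht.2.resolve_left hdc) (hs.2.resolve_left hdc)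

theorem NAlpha.genTerm_congr {n m : ℕ} {t s t' s' : NTerm} {π : NPerm} (hπ : permAtoms π ⊆ A)
    (hn : DepthLE n t) (hm : DepthLE m t')
    (ht : NAlpha S (permTerm π t) t') (hs : NAlpha S (permTerm π s) s') :
    NAlpha (pairCtx A S) (permTerm π (genTerm A S n t s)) (genTerm A S m t' s') := by
  induction n generalizing m t s t' s' π with
  | zero => exact hn.elim
  | succ n ih =>
    obtain _ | m := m
    · exact hm.elim
    have leaf := NAlpha.genLeaf_congr hπ ht hs
    cases t <;> cases s <;> simp only [permTerm_app, permTerm_atom, permTerm_abs,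
      permTerm_susp] at ht hs <;> cases t' <;> (try cases ht; done) <;> cases s' <;>
      (try cases hs; done)
    case app.app.app.app f ts g ss f' ts' g' ss' =>
      rw [NAlpha.app_iff] at ht hs
      obtain ⟨rfl, ht⟩ := ht
      obtain ⟨rfl, hs⟩ := hs
      have htl := ht.length_eq
      have hsl := hs.length_eq
      simp only [List.length_map] at htl hsl
      by_cases h : f = g ∧ ts.length = ss.length
      · obtain ⟨rfl, h⟩ := h
        rw [genTerm_app _ _ h, genTerm_app _ _ (by omega), permTerm_app, NAlpha.app_iff]
        refine ⟨rfl, ?_⟩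
        rw [List.forall₂_iff_get] at ht hs ⊢
        refine ⟨by simp; omega, fun i hi hi' => ?_⟩
        simp only [List.length_map, List.length_zipWith] at hi hi'
        have h1 := ht.2 i (by simp; omega) (by omega)
        have h2 := hs.2 i (by simp; omega) (by omega)
        simp only [List.get_eq_getElem, List.getElem_map, List.getElem_zipWith] at h1 h2 ⊢
        exact ih hπ (hn _ (by simp)) (hm _ (by simp)) h1 h2
      · rw [genTerm, genTerm, if_neg h, if_neg fun h' => h ⟨h'.1, by omega⟩]
        exact leaf
    case atom.atom.atom.atom a b a' b' =>
      cases ht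
      cases hs
      by_cases h : a = b
      · subst h
        simp only [genTerm, if_true, permTerm_atom]
        exact .atom _
      · rw [genTerm, genTerm, if_neg h, if_neg ((permAtom_injective π).ne h)]
        exact leaf
    case abs.abs.abs.abs a t b s a' t' b' s' =>
      by_cases h : ∃ c ∈ A, NFresh S c (.abs a t) ∧ NFresh S c (.abs b s)
      · have h' : ∃ c ∈ A, NFresh S c (.abs a' t') ∧ NFresh S c (.abs b' s') := by
          obtain ⟨c, hc, h1, h2⟩ := h
          exact ⟨permAtom π c, permAtom_mem hπ hc,
            (by simpa using h1.perm π : NFresh S _ _).alpha ht,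
            (by simpa using h2.perm π : NFresh S _ _).alpha hs⟩
        obtain ⟨c, hc, h1, h2, e⟩ := genTerm_abs n h
        obtain ⟨c', hc', h1', h2', e'⟩ := genTerm_abs m h'
        rw [e, e', permTerm_abs]
        refine NAlpha.abs_genTerm_congr
          (fun ρ hρ k l => ih hρ (DepthLE.permTerm (n := n) (t := t) hn _)
            (DepthLE.permTerm (n := m) (t := t') hm _) k l)
          hπ hc' (permAtom_mem hπ hc) ?_ ?_
        · have := (NAlpha.abs_rename h1).perm π
          simp only [permTerm_abs] at this
          exact (this.symm.trans ht).trans (NAlpha.abs_rename h1')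
        · have := (NAlpha.abs_rename h2).perm π
          simp only [permTerm_abs] at this
          exact (this.symm.trans hs).trans (NAlpha.abs_rename h2')
      · have h' : ¬ ∃ c ∈ A, NFresh S c (.abs a' t') ∧ NFresh S c (.abs b' s') := by
          rintro ⟨c, hc, h1, h2⟩
          have k := NAlpha.permInv_left (π := π) (t := .abs a t) (by simpa using ht)
          have l := NAlpha.permInv_left (π := π) (t := .abs b s) (by simpa using hs)
          exact h ⟨permAtom (permInv π) c,
            permAtom_mem (by rwa [permAtoms_permInv]) hc,
            (h1.perm _).alpha k, (h2.perm _).alpha l⟩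
        rw [genTerm, genTerm, dif_neg h, dif_neg h']
        exact leaf
    all_goals exact leaf

/-! ### The canonical generalization is the greatest one -/

theorem NAlpha.substTerm_genTerm {σ : NSubst} (i : NTerm × NTerm → NTerm)
    (hσ : ∀ p, σ (pairVar p) = i p) (hi : i = Prod.fst ∨ i = Prod.snd) (n : ℕ) (t s : NTerm) :
    NAlpha S (substTerm σ (genTerm A S n t s)) (i (t, s)) := by
  have leaf : ∀ t s, NAlpha S (substTerm σ (genLeaf A S t s)) (i (t, s)) := by
    intro t s
    rw [genLeaf, substTerm_susp, hσ]
    rcases hi with rfl | rfl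
    · exact (pairPerm_spec (t, s)).2.1
    · exact (pairPerm_spec (t, s)).2.2
  induction n generalizing t s with
  | zero => exact leaf t s
  | succ n ih =>
    refine genTerm_cases (P := fun u => NAlpha S (substTerm σ u) (i (t, s))) (leaf t s) ?_ ?_ ?_
    · rintro m f ts ss hm rfl rfl hl
      obtain rfl := Nat.succ.inj hm
      have key : ∀ us : List NTerm, us.length = ts.length →
          (∀ j (h : j < us.length) (h1 : j < ts.length) (h2 : j < ss.length),
            us[j] = i (ts[j], ss[j])) →
          NAlpha S (substTerm σ (.app f (List.zipWith (_root_.genTerm A S n) ts ss)))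
            (.app f us) := by
        intro us hus h
        rw [substTerm_app, NAlpha.app_iff, List.forall₂_iff_get]
        refine ⟨rfl, by simp; omega, fun j hj hj' => ?_⟩
        simp only [List.length_map, List.length_zipWith] at hj
        simp only [List.get_eq_getElem, List.getElem_map, List.getElem_zipWith]
        rw [h j hj' (by omega) (by omega)]
        exact ih _ _
      rcases hi with rfl | rfl
      · exact key ts rfl fun _ _ _ _ => rfl
      · exact key ss hl.symm fun _ _ _ _ => rfl
    · rintro m a - rfl rfl
      rw [substTerm_atom]
      rcases hi with rfl | rfl <;> exact .atom a
    · rintro m a b c t' s' hm rfl rfl - hct hcs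
      obtain rfl := Nat.succ.inj hm
      rw [substTerm_abs]
      have := ih (permTerm [(c, a)] t') (permTerm [(c, b)] s')
      rcases hi with rfl | rfl
      · exact (NAlpha.abs1 this).trans (NAlpha.abs_rename hct).symm
      · exact (NAlpha.abs1 this).trans (NAlpha.abs_rename hcs).symm

theorem NAlpha.substTerm_genTerm_depth {σ₁ σ₂ : NSubst} {N : Var → ℕ}
    (hN : ∀ X, DepthLE (N X) (σ₁ X)) {r : NTerm} (hr : termBased r A) {n : ℕ}
    (hn : DepthLE n (substTerm σ₁ r)) :
    NAlpha (pairCtx A S) (substTerm (fun X => _root_.genTerm A S (N X) (σ₁ X) (σ₂ X)) r)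
      (_root_.genTerm A S n (substTerm σ₁ r) (substTerm σ₂ r)) := by
  induction r using NTerm.inductOnMem generalizing n with
  | app f rs ih =>
    obtain _ | n := n
    · exact hn.elim
    rw [termBased_app] at hr
    simp only [substTerm_app, DepthLE, List.forall_mem_map] at hn ⊢
    rw [genTerm_app _ _ (by simp), NAlpha.app_iff, List.forall₂_iff_get]
    refine ⟨rfl, by simp, fun j hj _ => ?_⟩
    simp only [List.length_map] at hj
    simp only [List.get_eq_getElem, List.getElem_map, List.getElem_zipWith]
    exact ih _ (by simp) (hr _ (by simp)) (hn _ (by simp))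
  | atom a =>
    obtain _ | n := n
    · exact hn.elim
    simp only [substTerm_atom, _root_.genTerm, if_true]
    exact .atom a
  | abs a r ih =>
    obtain _ | n := n
    · exact hn.elim
    rw [termBased_abs] at hr
    simp only [substTerm_abs] at hn ⊢
    replace hn : DepthLE n (substTerm σ₁ r) := hn
    obtain ⟨c, hc, h1, h2, e⟩ := genTerm_abs (A := A) (S := S) n
      ⟨a, hr.1, NFresh.abs1 (t := substTerm σ₁ r), NFresh.abs1 (t := substTerm σ₂ r)⟩
    rw [e]
    refine (NAlpha.abs1 ((ih hr.2 hn).trans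
      (NAlpha.permTerm_self (π := []) (fun _ => rfl) _).symm)).trans ?_
    refine NAlpha.abs_genTerm_congr (π := [])
      (fun ρ hρ k l => NAlpha.genTerm_congr hρ hn (DepthLE.permTerm hn _) k l)
      (by simp [permAtoms]) hc hr.1 ?_ ?_
    · exact (NAlpha.abs1 (.permTerm_self (fun _ => rfl) _)).trans (NAlpha.abs_rename h1)
    · exact (NAlpha.abs1 (.permTerm_self (fun _ => rfl) _)).trans (NAlpha.abs_rename h2)
  | susp π X =>
    simp only [substTerm_susp] at hn ⊢
    exact NAlpha.genTerm_congr (termBased_susp.1 hr) (hN X) hn (.refl _) (.refl _)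

end

/-- Every `A`-based generalization lies below the canonical one, already for a finite part of
the context of the latter. -/
theorem IsGen.exists_finset_le_genTerm {A : Finset Atom} {Δ : FCtx} {t s : NTerm} {p : TIC}
    (hp : ticBased p A) (h : IsGen p (Δ, t) (Δ, s)) {n : ℕ} (hn : DepthLE n t) :
    ∃ F : FCtx, (F : Set (Atom × Var)) ⊆ pairCtx A Δ ∧
      ∀ G : FCtx, F ⊆ G → TIC.Le p (G, genTerm A Δ n t s) := by
  obtain ⟨⟨σ₁, -, hf₁, hα₁⟩, σ₂, -, hf₂, hα₂⟩ := h
  choose N hN using fun X => exists_depthLE (σ₁ X)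
  obtain ⟨m, hm⟩ := exists_depthLE (substTerm σ₁ p.2)
  set θ : NSubst := fun X => genTerm A Δ (N X) (σ₁ X) (σ₂ X) with hθ
  have hα : NAlpha (pairCtx A Δ) (substTerm θ p.2) (genTerm A Δ n t s) := by
    refine (NAlpha.substTerm_genTerm_depth hN hp.2 hm).trans ?_
    refine (NAlpha.permTerm_self (π := []) (fun _ => rfl) _).symm.trans ?_
    exact NAlpha.genTerm_congr (by simp [permAtoms]) hm hn
      ((NAlpha.permTerm_self (fun _ => rfl) _).trans hα₁)
      ((NAlpha.permTerm_self (fun _ => rfl) _).trans hα₂)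
  have hf : ∀ c ∈ p.1, NFresh (pairCtx A Δ) c.1 (θ c.2) := fun c hc =>
    .genTerm (hp.1 (Finset.mem_image_of_mem _ hc)) (hf₁ c hc) (hf₂ c hc)
  obtain ⟨F₁, hF₁, h₁⟩ := hα.exists_finset
  obtain ⟨F₂, hF₂, h₂⟩ := exists_finset_forall_mem_list
    (Q := fun S (c : Atom × Var) => NFresh S c.1 (θ c.2)) (fun _ _ _ h => NFresh.mono h)
    p.1.toList fun c hc => (hf c (by simpa using hc)).exists_finset
  refine ⟨F₁ ∪ F₂, by simp [hF₁, hF₂], fun G hG => ?_⟩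
  have hG₁ : (F₁ : Set (Atom × Var)) ⊆ G :=
    Finset.coe_subset.2 (Finset.union_subset_left hG)
  have hG₂ : (F₂ : Set (Atom × Var)) ⊆ G :=
    Finset.coe_subset.2 (Finset.union_subset_right hG)
  have hfG : ∀ c ∈ p.1, NFresh (G : Set (Atom × Var)) c.1 (θ c.2) := fun c hc =>
    (h₂ c (by simpa using hc)).mono hG₂
  exact ⟨θ, fun a X hc => (hfG _ hc).notMem_FAnoSusp, hfG, h₁.mono hG₁⟩

theorem isGen_genTerm {A : Finset Atom} {Δ G : FCtx} (hG : (G : Set (Atom × Var)) ⊆ pairCtx A Δ)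
    (n : ℕ) (t s : NTerm) : IsGen (G, genTerm A Δ n t s) (Δ, t) (Δ, s) :=
  ⟨⟨fun X => (varPair X).1, fun _ _ hc => (hG hc).2.1.notMem_FAnoSusp, fun _ hc => (hG hc).2.1,
      NAlpha.substTerm_genTerm Prod.fst (by simp) (.inl rfl) n t s⟩,
    ⟨fun X => (varPair X).2, fun _ _ hc => (hG hc).2.2.notMem_FAnoSusp, fun _ hc => (hG hc).2.2,
      NAlpha.substTerm_genTerm Prod.snd (by simp) (.inr rfl) n t s⟩⟩

/-- if `A₁ ⊆ A₂`, `⟨Δ,t⟩` and `⟨Δ,s⟩` are `A₁`-based with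
`A₁`-based lgg `⟨Γ₁,r₁⟩` and `A₂`-based lgg `⟨Γ₂,r₂⟩`, then `Γ₂ ⊢ r₁ ⪯ r₂`. -/
theorem lgg_atom_subset (A₁ A₂ : Finset Atom) (hsub : A₁ ⊆ A₂)
    (Δ Γ₁ Γ₂ : FCtx) (t s r₁ r₂ : NTerm)
    (ht : termBased t A₁) (hs : termBased s A₁) (hΔ : ctxBased Δ A₁)
    (h1 : IsABasedLgg A₁ (Γ₁, r₁) (Δ, t) (Δ, s))
    (h2 : IsABasedLgg A₂ (Γ₂, r₂) (Δ, t) (Δ, s)) :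
    ∃ φ : NSubst, NAlpha (↑Γ₂ : Set (Atom × Var)) (substTerm φ r₁) r₂ := by
  have ht₂ : termBased t A₂ := ht.trans hsub
  have h1' : ticBased (Γ₁, r₁) A₂ := ⟨h1.1.1.trans hsub, h1.1.2.trans hsub⟩
  obtain ⟨n, hn⟩ := exists_depthLE t
  obtain ⟨F₁, hF₁, hle₁⟩ := h1.2.1.exists_finset_le_genTerm h1' hn
  obtain ⟨F₂, hF₂, hle₂⟩ := h2.2.1.exists_finset_le_genTerm h2.1 hn
  have hF : ((F₁ ∪ F₂ : FCtx) : Set (Atom × Var)) ⊆ pairCtx A₂ Δ := by simp [hF₁, hF₂]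
  obtain ⟨θ, -, -, hθ⟩ := hle₁ (F₁ ∪ F₂) Finset.subset_union_left
  have hle : TIC.Le (F₁ ∪ F₂, genTerm A₂ Δ n t s) (Γ₂, r₂) := by
    refine by_contra fun hnot => h2.2.2 ⟨(F₁ ∪ F₂, genTerm A₂ Δ n t s), ⟨?_, ?_⟩,
      isGen_genTerm hF n t s, hle₂ _ Finset.subset_union_right, hnot⟩
    · intro a ha
      obtain ⟨c, hc, rfl⟩ := Finset.mem_image.1 ha
      exact (hF hc).1
    · exact termBased_genTerm ht₂
  obtain ⟨σ, -, hfσ, hσ⟩ := hle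
  refine ⟨substComp θ σ, ?_⟩
  rw [substTerm_substComp]
  exact (hθ.subst hfσ).trans hσ
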